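/- Let M and N be two matroids on the same finite ground set V. Then the list chromatic number of the complex M ∩ N of their common independent sets satisfies χ_ℓ(M ∩ N) ≤ χ(M) + χ(N): for every assignment of a list L_v of χ(M) + χ(N) colors to each v ∈ V, there exists a choice function f with f(v) ∈ L_v for every v ∈ V such that for every color c, the set f⁻¹(c) is independent in both M and N. -/

import Mathlib

/-- A matroid on a finite ground set `V`, identified with its collection of
independent sets (here given as a predicate on `Finset V`). -/
structure FinMatroid (V : Type*) [DecidableEq V] where
  Indep : Finset V → Prop
  empty_indep : Indep ∅
  subset_indep : ∀ ⦃S T : Finset V⦄, Indep T → S ⊆ T → Indep S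
  augment : ∀ ⦃S T : Finset V⦄, Indep S → Indep T → S.card < T.card →
    ∃ v ∈ T, v ∉ S ∧ Indep (insert v S)

/-- The chromatic number of a complex (given by the predicate `Ind` of its faces)
on the finite ground set `V`: the minimum number of faces whose union is `V`. -/
noncomputable def chrom {V : Type*} [Fintype V] (Ind : Finset V → Prop) : ℕ :=
  sInf {n | ∃ f : Fin n → Finset V, (∀ i, Ind (f i)) ∧ ∀ v : V, ∃ i, v ∈ f i}

section Exterior

open Finset

variable {E : Type*} [Fintype E] [DecidableEq E]

/-- The incidence sign of `v` with respect to the face `σ`. -/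
noncomputable def incidenceSign (v : E) (σ : Finset E) : ℝ :=
  (-1) ^ #{u ∈ σ | Fintype.equivFin E u < Fintype.equivFin E v}

omit [DecidableEq E] in
theorem incidenceSign_mul_self (v : E) (σ : Finset E) :
    incidenceSign v σ * incidenceSign v σ = 1 := by
  rw [incidenceSign, ← pow_add, ← two_mul, pow_mul]; simp

theorem incidenceSign_insert {u : E} (v : E) {σ : Finset E} (hu : u ∉ σ) :
    incidenceSign v (insert u σ) =
      (if Fintype.equivFin E u < Fintype.equivFin E v then -1 else 1) * incidenceSign v σ := by
  unfold incidenceSign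
  rw [filter_insert]
  split_ifs with h
  · rw [card_insert_of_notMem (by simp [hu]), pow_succ]; ring
  · simp

theorem incidenceSign_insert_self (v : E) (σ : Finset E) :
    incidenceSign v (insert v σ) = incidenceSign v σ := by
  unfold incidenceSign
  rw [filter_insert]; simp

theorem incidenceSign_erase_self (v : E) (σ : Finset E) :
    incidenceSign v (σ.erase v) = incidenceSign v σ := by
  rw [← incidenceSign_insert_self v (σ.erase v), ← incidenceSign_insert_self v σ]
  congr 1; ext x; by_cases x = v <;> simp_all

theorem incidenceSign_insert_mul_add {u v : E} (huv : u ≠ v) {σ : Finset E}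
    (hu : u ∉ σ) (hv : v ∉ σ) :
    incidenceSign u σ * incidenceSign v (insert u σ) +
      incidenceSign v σ * incidenceSign u (insert v σ) = 0 := by
  rw [incidenceSign_insert v hu, incidenceSign_insert u hv]
  have : Fintype.equivFin E u ≠ Fintype.equivFin E v := fun h => huv ((Equiv.injective _) h)
  rcases lt_or_gt_of_ne this with h | h
  · simp only [h, h.not_gt, if_true, if_false]; ring
  · simp only [h, h.not_gt, if_true, if_false]; ring

/-- Contraction of a chain by the vertex `v`. -/
noncomputable def contract (v : E) : Module.End ℝ (Finset E → ℝ) where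
  toFun φ σ := if v ∈ σ then 0 else incidenceSign v σ * φ (insert v σ)
  map_add' φ ψ := by ext σ; simp only [Pi.add_apply]; split_ifs <;> ring
  map_smul' c φ := by
    ext σ; simp only [Pi.smul_apply, smul_eq_mul, RingHom.id_apply]; split_ifs <;> ring

/-- Exterior multiplication of a cochain by the vertex `v`. -/
noncomputable def extend (v : E) : Module.End ℝ (Finset E → ℝ) where
  toFun φ σ := if v ∈ σ then incidenceSign v σ * φ (σ.erase v) else 0
  map_add' φ ψ := by ext σ; simp only [Pi.add_apply]; split_ifs <;> ring
  map_smul' c φ := by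
    ext σ; simp only [Pi.smul_apply, smul_eq_mul, RingHom.id_apply]; split_ifs <;> ring

theorem contract_apply (v : E) (φ : Finset E → ℝ) (σ : Finset E) :
    contract v φ σ = if v ∈ σ then 0 else incidenceSign v σ * φ (insert v σ) := rfl

theorem extend_apply (v : E) (φ : Finset E → ℝ) (σ : Finset E) :
    extend v φ σ = if v ∈ σ then incidenceSign v σ * φ (σ.erase v) else 0 := rfl

theorem contract_contract (u v : E) (φ : Finset E → ℝ) :
    contract u (contract v φ) + contract v (contract u φ) = 0 := by
  ext σ
  simp only [Pi.add_apply, contract_apply, mem_insert, Pi.zero_apply]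
  by_cases huv : u = v
  · subst huv; simp
  by_cases hu : u ∈ σ
  · simp [hu]
  by_cases hv : v ∈ σ
  · simp [hv]
  simp only [hu, hv, huv, Ne.symm huv, or_self, if_false]
  rw [insert_comm v u]
  linear_combination φ (insert u (insert v σ)) * incidenceSign_insert_mul_add huv hu hv

theorem extend_extend (u v : E) (φ : Finset E → ℝ) :
    extend u (extend v φ) + extend v (extend u φ) = 0 := by
  ext σ
  simp only [Pi.add_apply, extend_apply, mem_erase, Pi.zero_apply]
  by_cases huv : u = v
  · subst huv; simp
  by_cases hu : u ∈ σ
  swap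
  · simp [hu]
  by_cases hv : v ∈ σ
  swap
  · simp [hv]
  simp only [hu, hv, ne_eq, huv, Ne.symm huv, not_false_eq_true, and_self, if_true]
  obtain ⟨τ, hτu, hτv, rfl⟩ : ∃ τ, u ∉ τ ∧ v ∉ τ ∧ σ = insert u (insert v τ) :=
    ⟨(σ.erase u).erase v, by simp, by simp, by
      rw [insert_erase (by simp [hv, Ne.symm huv]), insert_erase hu]⟩
  have h1 : (insert u (insert v τ)).erase u = insert v τ := erase_insert (by simp [huv, hτu])
  have h2 : (insert u (insert v τ)).erase v = insert u τ := by
    rw [insert_comm]; exact erase_insert (by simp [Ne.symm huv, hτv])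
  rw [h1, h2, erase_insert hτu, erase_insert hτv, incidenceSign_insert_self,
    incidenceSign_insert_self, insert_comm, incidenceSign_insert_self, incidenceSign_insert_self]
  linear_combination φ τ * incidenceSign_insert_mul_add huv hτu hτv

theorem contract_extend (u v : E) (φ : Finset E → ℝ) :
    contract u (extend v φ) + extend v (contract u φ) = if u = v then φ else 0 := by
  ext σ
  simp only [Pi.add_apply, contract_apply, extend_apply, mem_insert, mem_erase]
  by_cases huv : u = v
  · subst huv
    by_cases hu : u ∈ σ
    · simp [hu, incidenceSign_erase_self, ← mul_assoc, incidenceSign_mul_self]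
    · simp [hu, incidenceSign_insert_self, ← mul_assoc, incidenceSign_mul_self]
  by_cases hu : u ∈ σ
  · simp [hu, huv]
  by_cases hv : v ∈ σ
  swap
  · simp [hv, huv, Ne.symm huv]
  simp only [hu, hv, huv, Ne.symm huv, or_true, if_true, if_false, and_false, Pi.zero_apply]
  obtain ⟨τ, hτv, rfl⟩ : ∃ τ, v ∉ τ ∧ σ = insert v τ :=
    ⟨σ.erase v, by simp, by rw [insert_erase hv]⟩
  have hτu : u ∉ τ := fun h => hu (by simp [h])
  rw [erase_insert hτv, insert_comm, erase_insert (by simp [Ne.symm huv, hτv]),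
    incidenceSign_insert_self, incidenceSign_insert_self]
  linear_combination φ (insert u τ) * incidenceSign u (insert v τ) * incidenceSign u τ *
      incidenceSign_insert_mul_add huv hτu hτv -
    φ (insert u τ) * incidenceSign u (insert v τ) * incidenceSign v (insert u τ) *
      incidenceSign_mul_self u τ -
    φ (insert u τ) * incidenceSign v τ * incidenceSign u τ *
      incidenceSign_mul_self u (insert v τ)

theorem extend_dotProduct (v : E) (φ ψ : Finset E → ℝ) :
    extend v φ ⬝ᵥ ψ = φ ⬝ᵥ contract v ψ := by
  simp only [dotProduct, extend_apply, contract_apply, ite_mul, mul_ite, zero_mul, mul_zero]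
  simp only [sum_ite, sum_const_zero, add_zero, zero_add]
  refine sum_nbij' (fun σ => σ.erase v) (fun σ => insert v σ) ?_ ?_ ?_ ?_ ?_ <;>
    simp +contextual [incidenceSign_erase_self, insert_erase]
  intros; ring

/-- The boundary operator in the directions of `S`. -/
noncomputable def boundary (S : Finset E) : Module.End ℝ (Finset E → ℝ) := ∑ v ∈ S, contract v

/-- The coboundary operator in the directions of `S`. -/
noncomputable def coboundary (S : Finset E) : Module.End ℝ (Finset E → ℝ) := ∑ v ∈ S, extend v

theorem boundary_apply (S : Finset E) (φ : Finset E → ℝ) :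
    boundary S φ = ∑ v ∈ S, contract v φ := by simp [boundary]

theorem coboundary_apply (S : Finset E) (φ : Finset E → ℝ) :
    coboundary S φ = ∑ v ∈ S, extend v φ := by simp [coboundary]

theorem boundary_boundary_add (S T : Finset E) (φ : Finset E → ℝ) :
    boundary S (boundary T φ) + boundary T (boundary S φ) = 0 := by
  simp only [boundary_apply, map_sum]
  rw [sum_comm (s := T), ← sum_add_distrib]
  exact sum_eq_zero fun u _ => by
    rw [← sum_add_distrib]
    exact sum_eq_zero fun v _ => by rw [add_comm]; exact contract_contract _ _ _

theorem boundary_boundary (S : Finset E) (φ : Finset E → ℝ) : boundary S (boundary S φ) = 0 :=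
  self_eq_neg.1 (eq_neg_of_add_eq_zero_left (boundary_boundary_add S S φ))

theorem coboundary_coboundary (S : Finset E) (φ : Finset E → ℝ) :
    coboundary S (coboundary S φ) = 0 := by
  refine self_eq_neg.1 (eq_neg_of_add_eq_zero_left ?_)
  simp only [coboundary_apply, map_sum]
  conv_lhs => enter [2]; rw [sum_comm]
  rw [← sum_add_distrib]
  exact sum_eq_zero fun u _ => by
    rw [← sum_add_distrib]
    exact sum_eq_zero fun v _ => extend_extend _ _ _

theorem coboundary_dotProduct (S : Finset E) (φ ψ : Finset E → ℝ) :
    coboundary S φ ⬝ᵥ ψ = φ ⬝ᵥ boundary S ψ := by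
  simp only [coboundary_apply, boundary_apply, sum_dotProduct, dotProduct_sum, extend_dotProduct]

theorem boundary_coboundary_add (S : Finset E) (φ : Finset E → ℝ) :
    boundary S (coboundary S φ) + coboundary S (boundary S φ) = (#S : ℝ) • φ := by
  simp only [coboundary_apply, boundary_apply, map_sum]
  conv_lhs => enter [2]; rw [sum_comm]
  rw [← sum_add_distrib]
  have : ∀ v ∈ S, ∑ u ∈ S, contract u (extend v φ) + ∑ u ∈ S, extend v (contract u φ) = φ := by
    intro v hv
    simp_rw [← sum_add_distrib, contract_extend]
    simp [hv]
  rw [sum_congr rfl this]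
  simp [Nat.cast_smul_eq_nsmul]

theorem coboundary_dotProduct_self_add (S : Finset E) (φ : Finset E → ℝ) :
    coboundary S φ ⬝ᵥ coboundary S φ + boundary S φ ⬝ᵥ boundary S φ = #S * (φ ⬝ᵥ φ) := by
  have h := congrArg (φ ⬝ᵥ ·) (boundary_coboundary_add S φ)
  simp only [dotProduct_add, dotProduct_smul, smul_eq_mul] at h
  rw [← h, ← coboundary_dotProduct, dotProduct_comm φ (coboundary S (boundary S φ)),
    coboundary_dotProduct]

end Exterior

section Filling

open Finset

/-- Every vector splits along a submodule and its orthogonal complement for the dot product. -/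
theorem exists_mem_add_dotProduct_eq_zero {ι : Type*} [Fintype ι] (P : Submodule ℝ (ι → ℝ))
    (z : ι → ℝ) : ∃ p ∈ P, ∃ q, z = p + q ∧ ∀ x ∈ P, x ⬝ᵥ q = 0 := by
  let e := WithLp.linearEquiv 2 ℝ (ι → ℝ)
  obtain ⟨p, hp, q, hq, h⟩ :=
    (P.comap e.toLinearMap).exists_add_mem_mem_orthogonal (e.symm z)
  refine ⟨e p, hp, e q, ?_, fun x hx => ?_⟩
  · rw [← map_add, ← h, LinearEquiv.apply_symm_apply]
  · have := (Submodule.mem_orthogonal _ _).1 hq (e.symm x) (by simpa using hx)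
    rw [EuclideanSpace.inner_eq_star_dotProduct, dotProduct_comm] at this
    exact this

variable {E : Type*} [Fintype E] [DecidableEq E]

/-- A complex for which a face of size `d` spans at most `a * d` points, with the span of a
nonface constant along the faces obtained by deleting one point. -/
def SpanBound (Ind : Finset E → Prop) (a : ℕ) : Prop :=
  ∃ cl : Finset E → Finset E, (∀ ω, ω ⊆ cl ω) ∧
    (∀ ω, ∀ v ∈ ω, ¬ Ind ω → Ind (ω.erase v) → cl (ω.erase v) = cl ω) ∧
    ∀ σ, Ind σ → #(cl σ) ≤ a * #σ

theorem coboundary_apply_apply (S : Finset E) (φ : Finset E → ℝ) (ω : Finset E) :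
    coboundary S φ ω =
      ∑ v ∈ S, if v ∈ ω then incidenceSign v ω * φ (ω.erase v) else 0 := by
  simp [coboundary_apply, extend_apply]

theorem boundary_apply_apply (S : Finset E) (φ : Finset E → ℝ) (ω : Finset E) :
    boundary S φ ω =
      ∑ v ∈ S, if v ∈ ω then 0 else incidenceSign v ω * φ (insert v ω) := by
  simp [boundary_apply, contract_apply]

theorem dotProduct_self_nonneg_real {ι : Type*} [Fintype ι] (x : ι → ℝ) : 0 ≤ x ⬝ᵥ x :=
  sum_nonneg fun i _ => mul_self_nonneg (x i)

open Classical in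
theorem SpanBound.sum_sq_coboundary_le {Ind : Finset E → Prop} {a d : ℕ} (h : SpanBound Ind a)
    (U : Finset E) {q : Finset E → ℝ} (hq : ∀ σ, q σ ≠ 0 → Ind σ ∧ #σ = d) :
    ∑ ω with ¬ Ind ω, coboundary U q ω ^ 2 ≤ (a * d : ℕ) * (q ⬝ᵥ q) := by
  obtain ⟨cl, hsub, hcl, hcard⟩ := h
  let r : Finset E → Finset E → ℝ := fun F σ => if cl σ = F then q σ else 0
  have key : ∀ ω, ¬ Ind ω → coboundary U q ω = coboundary (U ∩ cl ω) (r (cl ω)) ω := by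
    intro ω hω
    rw [coboundary_apply_apply, coboundary_apply_apply]
    symm
    refine (sum_subset inter_subset_left fun v hv hv' => ?_).trans (sum_congr rfl fun v _ => ?_)
    · rw [if_neg fun h => hv' (mem_inter.2 ⟨hv, hsub ω h⟩)]
    · split_ifs with hvω
      · congr 1
        by_cases h0 : q (ω.erase v) = 0
        · simp [r, h0]
        · simp [r, hcl ω v hvω hω (hq _ h0).1]
      · rfl
  calc ∑ ω with ¬ Ind ω, coboundary U q ω ^ 2
      ≤ ∑ ω with ¬ Ind ω, ∑ F, coboundary (U ∩ F) (r F) ω ^ 2 := by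
        refine sum_le_sum fun ω hω => ?_
        rw [key ω (mem_filter.1 hω).2]
        exact single_le_sum (f := fun F => coboundary (U ∩ F) (r F) ω ^ 2)
          (fun F _ => sq_nonneg _) (mem_univ (cl ω))
    _ ≤ ∑ ω, ∑ F, coboundary (U ∩ F) (r F) ω ^ 2 :=
        sum_le_sum_of_subset_of_nonneg (filter_subset _ _) fun ω _ _ =>
          sum_nonneg fun F _ => sq_nonneg _
    _ = ∑ F, coboundary (U ∩ F) (r F) ⬝ᵥ coboundary (U ∩ F) (r F) := by
        rw [sum_comm]; simp only [dotProduct, sq]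
    _ ≤ ∑ F, #(U ∩ F) * (r F ⬝ᵥ r F) := by
        refine sum_le_sum fun F _ => ?_
        rw [← coboundary_dotProduct_self_add]
        exact le_add_of_nonneg_right (dotProduct_self_nonneg_real _)
    _ ≤ ∑ F, (a * d : ℕ) * (r F ⬝ᵥ r F) := by
        refine sum_le_sum fun F _ => ?_
        simp only [dotProduct, mul_sum]
        refine sum_le_sum fun σ _ => ?_
        by_cases h0 : r F σ = 0
        · simp [h0]
        · refine mul_le_mul_of_nonneg_right ?_ (mul_self_nonneg _)
          have hF : cl σ = F := by by_contra hF; exact h0 (if_neg hF)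
          have hσ := hq σ fun h => h0 (by simp [r, h])
          rw [← hF, ← hσ.2]
          exact_mod_cast (card_le_card inter_subset_right).trans (hcard σ hσ.1)
    _ = (a * d : ℕ) * (q ⬝ᵥ q) := by
        rw [← mul_sum]
        congr 1
        simp only [dotProduct]
        rw [sum_comm]
        refine sum_congr rfl fun σ _ => ?_
        simp [r]

/-- The chains of a complex supported on the faces of size `d` inside `U`. -/
def chains (K : Finset E → Prop) (U : Finset E) (d : ℕ) : Submodule ℝ (Finset E → ℝ) where
  carrier := {φ | ∀ σ, φ σ ≠ 0 → K σ ∧ σ ⊆ U ∧ #σ = d}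
  zero_mem' := by simp
  add_mem' := by
    intro φ ψ hφ hψ σ h
    by_cases h0 : φ σ = 0
    · exact hψ σ (by simpa [h0] using h)
    · exact hφ σ h0
  smul_mem' := by
    intro c φ hφ σ h
    exact hφ σ (right_ne_zero_of_mul h)

omit [Fintype E] [DecidableEq E] in
theorem chains_mono {K : Finset E → Prop} {U U' : Finset E} (h : U ⊆ U') (d : ℕ) :
    chains K U d ≤ chains K U' d :=
  fun _ hφ σ hσ => ⟨(hφ σ hσ).1, (hφ σ hσ).2.1.trans h, (hφ σ hσ).2.2⟩

theorem contract_eq_zero_of_mem_chains {K : Finset E → Prop} {U : Finset E} {d : ℕ}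
    {φ : Finset E → ℝ} (hφ : φ ∈ chains K U d) {v : E} (hv : v ∉ U) : contract v φ = 0 := by
  ext σ
  rw [contract_apply]
  split_ifs
  · rfl
  · rw [Pi.zero_apply, mul_eq_zero]
    by_contra! h
    exact hv ((hφ _ h.2).2.1 (mem_insert_self v σ))

theorem boundary_eq_of_mem_chains {K : Finset E → Prop} {U T : Finset E} {d : ℕ}
    {φ : Finset E → ℝ} (hφ : φ ∈ chains K U d) (hT : U ⊆ T) : boundary T φ = boundary U φ := by
  rw [boundary_apply, boundary_apply]
  exact (sum_subset hT fun v _ hv => contract_eq_zero_of_mem_chains hφ hv).symm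

theorem boundary_mem_chains {K : Finset E → Prop} (hK : ∀ ⦃σ τ⦄, K τ → σ ⊆ τ → K σ)
    {U T : Finset E} {d : ℕ} {φ : Finset E → ℝ} (hφ : φ ∈ chains K U (d + 1)) :
    boundary T φ ∈ chains K U d := by
  rw [boundary_apply]
  refine Submodule.sum_mem _ fun v _ σ hσ => ?_
  rw [contract_apply] at hσ
  split_ifs at hσ with hv
  · simp at hσ
  · obtain ⟨h1, h2, h3⟩ := hφ _ (right_ne_zero_of_mul hσ)
    rw [card_insert_of_notMem hv] at h3
    exact ⟨hK h1 (subset_insert _ _), (subset_insert _ _).trans h2, by omega⟩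

theorem exists_boundary_eq {IM IN : Finset E → Prop} {a b d : ℕ} (hM : SpanBound IM a)
    (hN : SpanBound IN b) (hIM : ∀ ⦃σ τ⦄, IM τ → σ ⊆ τ → IM σ)
    (hIN : ∀ ⦃σ τ⦄, IN τ → σ ⊆ τ → IN σ) {U : Finset E} (hU : (a + b) * d < #U)
    {z : Finset E → ℝ} (hz : z ∈ chains (fun σ => IM σ ∧ IN σ) U d)
    (hz0 : boundary univ z = 0) :
    ∃ w ∈ chains (fun σ => IM σ ∧ IN σ) U (d + 1), boundary univ w = z := by
  classical
  set K : Finset E → Prop := fun σ => IM σ ∧ IN σ with hKdef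
  have hK : ∀ ⦃σ τ⦄, K τ → σ ⊆ τ → K σ := fun σ τ h hs => ⟨hIM h.1 hs, hIN h.2 hs⟩
  obtain ⟨p, hp, q, rfl, hq⟩ :=
    exists_mem_add_dotProduct_eq_zero ((chains K U (d + 1)).map (boundary univ)) z
  obtain ⟨w, hw, rfl⟩ := hp
  refine ⟨w, hw, ?_⟩
  have hqc : q ∈ chains K U d := by
    simpa using Submodule.sub_mem _ hz (boundary_mem_chains hK (T := univ) hw)
  have hq0 : boundary U q = 0 := by
    rw [map_add, boundary_boundary, zero_add] at hz0
    rw [← boundary_eq_of_mem_chains hqc (subset_univ U), hz0]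
  have hcob : ∀ ω, K ω → coboundary U q ω = 0 := by
    intro ω hω
    by_contra hne
    have hωU : ω ⊆ U ∧ #ω = d + 1 := by
      rw [coboundary_apply_apply] at hne
      obtain ⟨v, hv, hne⟩ := exists_ne_zero_of_sum_ne_zero hne
      split_ifs at hne with hvω
      · obtain ⟨-, h2, h3⟩ := hqc _ (right_ne_zero_of_mul hne)
        refine ⟨?_, by rw [← card_erase_add_one hvω, h3]⟩
        rw [← insert_erase hvω]
        exact insert_subset hv h2
      · exact absurd rfl hne
    have hs : Pi.single ω (1 : ℝ) ∈ chains K U (d + 1) := by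
      intro σ hσ
      obtain rfl : σ = ω := by by_contra h; simp [h] at hσ
      exact ⟨hω, hωU⟩
    have := hq _ (Submodule.mem_map_of_mem hs)
    rw [boundary_eq_of_mem_chains hs (subset_univ U), dotProduct_comm,
      ← coboundary_dotProduct, dotProduct_single_one] at this
    exact hne this
  have hsum : (#U : ℝ) * (q ⬝ᵥ q) ≤ ((a + b) * d : ℕ) * (q ⬝ᵥ q) := by
    rw [← coboundary_dotProduct_self_add, hq0, zero_dotProduct, add_zero]
    calc coboundary U q ⬝ᵥ coboundary U q
        = ∑ ω with ¬ K ω, coboundary U q ω ^ 2 := by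
          rw [dotProduct, sum_filter]
          refine sum_congr rfl fun ω _ => ?_
          split_ifs with h
          · rw [hcob ω h, mul_zero]
          · rw [sq]
      _ ≤ ∑ ω with ¬ IM ω, coboundary U q ω ^ 2 + ∑ ω with ¬ IN ω, coboundary U q ω ^ 2 := by
          rw [← sum_union_inter]
          refine le_add_of_le_of_nonneg (sum_le_sum_of_subset_of_nonneg ?_
            fun _ _ _ => sq_nonneg _) (sum_nonneg fun _ _ => sq_nonneg _)
          intro ω
          simp only [mem_filter, mem_univ, true_and, mem_union, hKdef]
          tauto
      _ ≤ (a * d : ℕ) * (q ⬝ᵥ q) + (b * d : ℕ) * (q ⬝ᵥ q) :=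
          add_le_add
            (hM.sum_sq_coboundary_le U fun σ hσ => ⟨(hqc σ hσ).1.1, (hqc σ hσ).2.2⟩)
            (hN.sum_sq_coboundary_le U fun σ hσ => ⟨(hqc σ hσ).1.2, (hqc σ hσ).2.2⟩)
      _ = ((a + b) * d : ℕ) * (q ⬝ᵥ q) := by push_cast; ring
  have hqq : q ⬝ᵥ q = 0 := by
    by_contra hne
    have hpos := lt_of_le_of_ne (dotProduct_self_nonneg_real q) (Ne.symm hne)
    have := le_of_mul_le_mul_right hsum hpos
    exact absurd (by exact_mod_cast this : #U ≤ (a + b) * d) (by omega)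
  rw [dotProduct_self_eq_zero.1 hqq, add_zero]

end Filling

section Transversal

open Finset

variable {E V : Type*} [Fintype E] [DecidableEq E] [Fintype V] [DecidableEq V]

/-- The boundary operator in the directions lying over the point `v`. -/
noncomputable def fiberBoundary (π : E → V) (v : V) : Module.End ℝ (Finset E → ℝ) :=
  boundary {e | π e = v}

omit [Fintype V] in
theorem fiberBoundary_comm (π : E → V) (u v : V) (φ : Finset E → ℝ) :
    fiberBoundary π u (fiberBoundary π v φ) = - fiberBoundary π v (fiberBoundary π u φ) :=
  eq_neg_of_add_eq_zero_left (boundary_boundary_add _ _ φ)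

theorem sum_fiberBoundary (π : E → V) (φ : Finset E → ℝ) :
    ∑ v, fiberBoundary π v φ = boundary univ φ := by
  simp only [fiberBoundary, boundary_apply]
  exact sum_fiberwise univ π fun e => contract e φ

omit [Fintype V] in
theorem fiberBoundary_eq_zero {π : E → V} {K : Finset E → Prop} {X : Finset V} {d : ℕ}
    {φ : Finset E → ℝ} (hφ : φ ∈ chains K {e | π e ∈ X} d) {v : V} (hv : v ∉ X) :
    fiberBoundary π v φ = 0 := by
  rw [fiberBoundary, boundary_apply]
  refine sum_eq_zero fun e he => contract_eq_zero_of_mem_chains hφ ?_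
  simpa [(mem_filter.1 he).2] using hv

/-- The composition of the boundary operators over the points of a list. -/
noncomputable def listBoundary (π : E → V) (l : List V) : Module.End ℝ (Finset E → ℝ) :=
  (l.map (fiberBoundary π)).prod

omit [Fintype V] in
theorem listBoundary_cons (π : E → V) (v : V) (l : List V) (φ : Finset E → ℝ) :
    listBoundary π (v :: l) φ = fiberBoundary π v (listBoundary π l φ) := by
  simp [listBoundary]

omit [Fintype V] in
theorem listBoundary_concat (π : E → V) (v : V) (l : List V) (φ : Finset E → ℝ) :
    listBoundary π (l ++ [v]) φ = listBoundary π l (fiberBoundary π v φ) := by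
  simp [listBoundary]

omit [Fintype V] in
theorem fiberBoundary_listBoundary {π : E → V} {v : V} {φ : Finset E → ℝ}
    (h : fiberBoundary π v φ = 0) (l : List V) :
    fiberBoundary π v (listBoundary π l φ) = 0 := by
  induction l with
  | nil => simpa [listBoundary] using h
  | cons u l ih => rw [listBoundary_cons, fiberBoundary_comm, ih, map_zero, neg_zero]

omit [Fintype V] in
theorem listBoundary_eq_zero {π : E → V} {v : V} {φ : Finset E → ℝ}
    (h : fiberBoundary π v φ = 0) {l : List V} (hl : v ∈ l) : listBoundary π l φ = 0 := by
  induction l with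
  | nil => simp at hl
  | cons u l ih =>
    rw [listBoundary_cons]
    by_cases huv : v = u
    · rw [← huv, fiberBoundary_listBoundary h]
    · rw [ih (by simpa [huv] using hl), map_zero]

omit [Fintype V] in
theorem exists_superset_of_listBoundary_ne_zero {π : E → V} {φ : Finset E → ℝ} (l : List V)
    {τ : Finset E} (h : listBoundary π l φ τ ≠ 0) :
    ∃ σ, τ ⊆ σ ∧ φ σ ≠ 0 ∧ ∀ v ∈ l, ∃ e ∈ σ, π e = v := by
  induction l generalizing τ with
  | nil => exact ⟨τ, Subset.rfl, by simpa [listBoundary] using h, by simp⟩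
  | cons u l ih =>
    rw [listBoundary_cons, fiberBoundary, boundary_apply_apply] at h
    obtain ⟨e, he, h⟩ := exists_ne_zero_of_sum_ne_zero h
    split_ifs at h
    · exact absurd rfl h
    obtain ⟨σ, h1, h2, h3⟩ := ih (right_ne_zero_of_mul h)
    refine ⟨σ, (subset_insert _ _).trans h1, h2, ?_⟩
    rintro v (_ | ⟨_, hv⟩)
    · exact ⟨e, h1 (mem_insert_self _ _), (mem_filter.1 he).2⟩
    · exact h3 v hv

omit [DecidableEq V] in
theorem incidenceSign_ne_zero (v : V) (X : Finset V) : incidenceSign v X ≠ 0 := by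
  simp [incidenceSign]

theorem coboundary_univ_apply (φ : Finset V → ℝ) (X : Finset V) :
    coboundary univ φ X = ∑ v ∈ X, incidenceSign v X * φ (X.erase v) := by
  rw [coboundary_apply_apply, ← sum_filter]
  simp

/-- An augmented chain map from the full simplex on `V`, up to dimension `n`, which carries each
face `X` to a chain lying over `X`. -/
def IsCarriedMap (K : Finset E → Prop) (π : E → V) (n : ℕ) (g : Finset V → Finset E → ℝ) : Prop :=
  g ∅ = Pi.single ∅ 1 ∧ ∀ X, #X ≤ n → g X ∈ chains K {e | π e ∈ X} #X ∧
    boundary univ (g X) = ∑ v ∈ X, incidenceSign v X • g (X.erase v)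

theorem IsCarriedMap.boundary_sum_eq_zero {K : Finset E → Prop} {π : E → V} {n : ℕ}
    {g : Finset V → Finset E → ℝ} (hg : IsCarriedMap K π n g) {X : Finset V} (hX : #X = n + 1) :
    boundary univ (∑ v ∈ X, incidenceSign v X • g (X.erase v)) = 0 := by
  ext τ
  have := congrFun (coboundary_coboundary univ fun Y => g Y τ) X
  rw [coboundary_univ_apply] at this
  rw [map_sum, Finset.sum_apply, Pi.zero_apply]
  refine Eq.trans ?_ this
  refine sum_congr rfl fun v hv => ?_
  rw [map_smul, (hg.2 _ (by rw [card_erase_of_mem hv]; omega)).2, coboundary_univ_apply]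
  simp

theorem exists_isCarriedMap {IM IN : Finset E → Prop} {a b : ℕ} (hM : SpanBound IM a)
    (hN : SpanBound IN b) (hIM : ∀ ⦃σ τ⦄, IM τ → σ ⊆ τ → IM σ)
    (hIN : ∀ ⦃σ τ⦄, IN τ → σ ⊆ τ → IN σ) (hM0 : IM ∅) (hN0 : IN ∅) (π : E → V)
    (hab : 0 < a + b) (hπ : ∀ v, a + b ≤ #{e | π e = v}) (n : ℕ) :
    ∃ g, IsCarriedMap (fun σ => IM σ ∧ IN σ) π n g := by
  induction n with
  | zero =>
    refine ⟨fun _ => Pi.single ∅ 1, rfl, fun X hX => ?_⟩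
    obtain rfl : X = ∅ := by simpa using hX
    refine ⟨fun σ hσ => ?_, ?_⟩
    · obtain rfl : σ = ∅ := by by_contra h; simp [h] at hσ
      simp [hM0, hN0]
    · ext τ
      simp [boundary_apply_apply]
  | succ n ih =>
    obtain ⟨g, hg⟩ := ih
    have step : ∀ X : Finset V, #X = n + 1 →
        ∃ w ∈ chains (fun σ => IM σ ∧ IN σ) {e | π e ∈ X} (n + 1),
          boundary univ w = ∑ v ∈ X, incidenceSign v X • g (X.erase v) := by
      intro X hX
      refine exists_boundary_eq hM hN hIM hIN ?_ (Submodule.sum_mem _ fun v hv => ?_)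
        (hg.boundary_sum_eq_zero hX)
      · have h1 : (a + b) * #X ≤ #{e | π e ∈ X} := by
          refine mul_card_image_le_card_of_maps_to (f := π) (by simp) _ fun v hv => ?_
          rw [filter_filter]
          refine (hπ v).trans (card_le_card fun e => ?_)
          simp only [mem_filter, mem_univ, true_and]
          exact fun h => ⟨h ▸ hv, h⟩
        rw [hX] at h1
        nlinarith
      · have hc : #(X.erase v) = n := by rw [card_erase_of_mem hv]; omega
        refine Submodule.smul_mem _ _ (chains_mono ?_ n (hc ▸ (hg.2 _ hc.le).1))
        intro e
        simp only [mem_filter, mem_univ, true_and]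
        exact fun h => mem_of_mem_erase h
    choose w hw hwb using step
    refine ⟨fun X => if h : #X = n + 1 then w X h else g X, by simpa using hg.1, fun X hX => ?_⟩
    have hlow : ∀ v ∈ X, #(X.erase v) ≠ n + 1 := fun v hv => by
      rw [card_erase_of_mem hv]; omega
    have hsum : ∑ v ∈ X, incidenceSign v X • (fun X => if h : #X = n + 1 then w X h else g X)
        (X.erase v) = ∑ v ∈ X, incidenceSign v X • g (X.erase v) :=
      sum_congr rfl fun v hv => by simp only [dif_neg (hlow v hv)]
    rw [hsum]
    by_cases h : #X = n + 1
    · simp only [dif_pos h]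
      exact ⟨by rw [h]; exact hw X h, hwb X h⟩
    · simp only [dif_neg h]
      exact hg.2 X (by omega)

theorem IsCarriedMap.listBoundary_ne_zero {K : Finset E → Prop} {π : E → V}
    {g : Finset V → Finset E → ℝ} (hg : IsCarriedMap K π (Fintype.card V) g) {l : List V}
    (hl : l.Nodup) : listBoundary π l (g l.toFinset) ∅ ≠ 0 := by
  induction l using List.reverseRecOn with
  | nil => simp [listBoundary, hg.1]
  | append_singleton l v₀ ih =>
    have hv₀ : v₀ ∉ l := by
      intro h
      exact (List.nodup_append.1 hl).2.2 v₀ h v₀ (by simp) rfl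
    have hX : (l ++ [v₀]).toFinset = insert v₀ l.toFinset := by ext; simp
    rw [listBoundary_concat, hX]
    set X := insert v₀ l.toFinset with hXdef
    have hgX := fun Y : Finset V => hg.2 Y (card_le_univ Y)
    have h1 : listBoundary π l (boundary univ (g X)) =
        listBoundary π l (fiberBoundary π v₀ (g X)) := by
      rw [← sum_fiberBoundary π, map_sum]
      refine sum_eq_single v₀ (fun v _ hv => ?_) (by simp)
      by_cases hvl : v ∈ l
      · exact listBoundary_eq_zero (boundary_boundary _ _) hvl
      · rw [fiberBoundary_eq_zero (hgX X).1 (by simp [hXdef, hv, hvl]), map_zero]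
    have h2 : listBoundary π l (boundary univ (g X)) =
        incidenceSign v₀ X • listBoundary π l (g l.toFinset) := by
      rw [(hgX X).2, map_sum, sum_eq_single_of_mem v₀ (mem_insert_self _ _), map_smul,
        hXdef, erase_insert (by simpa using hv₀)]
      intro v hv hne
      rw [map_smul, listBoundary_eq_zero (v := v) (fiberBoundary_eq_zero (hgX _).1 (by simp)),
        smul_zero]
      simpa [hXdef, hne] using hv
    rw [← h1, h2]
    exact mul_ne_zero (incidenceSign_ne_zero _ _) (ih (List.nodup_append.1 hl).1)

theorem exists_transversal {IM IN : Finset E → Prop} {a b : ℕ} (hM : SpanBound IM a)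
    (hN : SpanBound IN b) (hIM : ∀ ⦃σ τ⦄, IM τ → σ ⊆ τ → IM σ)
    (hIN : ∀ ⦃σ τ⦄, IN τ → σ ⊆ τ → IN σ) (hM0 : IM ∅) (hN0 : IN ∅) (π : E → V)
    (hab : 0 < a + b) (hπ : ∀ v, a + b ≤ #{e | π e = v}) :
    ∃ σ, IM σ ∧ IN σ ∧ ∀ v, ∃ e ∈ σ, π e = v := by
  obtain ⟨g, hg⟩ :=
    exists_isCarriedMap hM hN hIM hIN hM0 hN0 π hab hπ (Fintype.card V)
  obtain ⟨σ, -, hσ, h⟩ := exists_superset_of_listBoundary_ne_zero _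
    (hg.listBoundary_ne_zero (univ : Finset V).nodup_toList)
  rw [toList_toFinset] at hσ
  have hK := ((hg.2 univ le_rfl).1 σ hσ).1
  exact ⟨σ, hK.1, hK.2, fun v => h v (by simp)⟩

end Transversal

section FinMatroid

open Finset

variable {V : Type*} [DecidableEq V]

/-- The Mathlib matroid with the same independent sets. -/
noncomputable def FinMatroid.toMatroid (M : FinMatroid V) : Matroid V :=
  (IndepMatroid.ofFinset Set.univ M.Indep M.empty_indep (fun _ _ h h' => M.subset_indep h h')
    (fun I J hI hJ h => by
      obtain ⟨v, hv, hvI, h⟩ := M.augment hI hJ h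
      exact ⟨v, hv, hvI, h⟩)
    (fun _ _ => Set.subset_univ _)).matroid

theorem FinMatroid.toMatroid_indep {M : FinMatroid V} {I : Finset V} :
    M.toMatroid.Indep (I : Set V) ↔ M.Indep I := by
  simp [FinMatroid.toMatroid]

variable [Fintype V]

open Classical in
/-- The closure of a set in a matroid. -/
noncomputable def FinMatroid.closure (M : FinMatroid V) (S : Finset V) : Finset V :=
  {v | v ∈ M.toMatroid.closure S}

theorem FinMatroid.coe_closure (M : FinMatroid V) (S : Finset V) :
    (M.closure S : Set V) = M.toMatroid.closure S := by
  simp [FinMatroid.closure]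

theorem FinMatroid.subset_closure (M : FinMatroid V) (S : Finset V) : S ⊆ M.closure S := by
  rw [← coe_subset, M.coe_closure]
  exact M.toMatroid.subset_closure _ (Set.subset_univ _)

theorem FinMatroid.closure_erase {M : FinMatroid V} {S : Finset V} {v : V} (hv : v ∈ S)
    (hS : ¬ M.Indep S) (hSv : M.Indep (S.erase v)) : M.closure (S.erase v) = M.closure S := by
  have hmem : v ∈ M.toMatroid.closure (S.erase v : Finset V) := by
    rw [(toMatroid_indep.2 hSv).mem_closure_iff', ← coe_insert, insert_erase hv,
      toMatroid_indep]
    exact ⟨Set.mem_univ _, fun h => absurd h hS⟩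
  rw [← coe_inj, M.coe_closure, M.coe_closure,
    ← M.toMatroid.closure_insert_eq_of_mem_closure hmem, ← coe_insert, insert_erase hv]

theorem FinMatroid.card_le_of_subset_closure {M : FinMatroid V} {I J : Finset V}
    (hI : M.Indep I) (hJ : M.Indep J) (h : J ⊆ M.closure I) : #J ≤ #I := by
  have h' : (J : Set V) ⊆ M.toMatroid.closure I := by
    rw [← M.coe_closure]; exact_mod_cast h
  have := (toMatroid_indep.2 hJ).encard_le_eRk_of_subset h'
  rw [Matroid.eRk_closure_eq, (toMatroid_indep.2 hI).eRk_eq_encard] at this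
  simpa using this

theorem FinMatroid.exists_cover (M : FinMatroid V) (hM : ∀ v, M.Indep {v}) :
    ∃ f : Fin (chrom M.Indep) → Finset V, (∀ i, M.Indep (f i)) ∧ ∀ v, ∃ i, v ∈ f i := by
  refine Nat.sInf_mem (s := {n | ∃ f : Fin n → Finset V, (∀ i, M.Indep (f i)) ∧
    ∀ v, ∃ i, v ∈ f i}) ⟨Fintype.card V, fun i => {(Fintype.equivFin V).symm i},
      fun i => hM _, fun v => ⟨Fintype.equivFin V v, by simp⟩⟩

theorem FinMatroid.card_closure_le {M : FinMatroid V} (hM : ∀ v, M.Indep {v}) {I : Finset V}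
    (hI : M.Indep I) : #(M.closure I) ≤ chrom M.Indep * #I := by
  obtain ⟨f, hf, hcov⟩ := M.exists_cover hM
  calc #(M.closure I) ≤ #(univ.biUnion fun i => f i ∩ M.closure I) := by
        refine card_le_card fun v hv => ?_
        obtain ⟨i, hi⟩ := hcov v
        exact mem_biUnion.2 ⟨i, mem_univ _, mem_inter.2 ⟨hi, hv⟩⟩
    _ ≤ #(univ : Finset (Fin (chrom M.Indep))) * #I :=
        card_biUnion_le_card_mul _ _ _ fun i _ =>
          card_le_of_subset_closure hI (M.subset_indep (hf i) inter_subset_left) inter_subset_right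
    _ = chrom M.Indep * #I := by simp

variable {Color : Type*} [DecidableEq Color] {L : V → Finset Color}

/-- The set of elements which receive the color `c` in a set of element-color pairs. -/
def colorClass (c : Color) (σ : Finset (Σ v, L v)) : Finset V :=
  {e ∈ σ | (e.2 : Color) = c}.image Sigma.fst

omit [Fintype V] in
theorem mem_colorClass {c : Color} {σ : Finset (Σ v, L v)} {v : V} :
    v ∈ colorClass c σ ↔ ∃ x : L v, (⟨v, x⟩ : Σ v, L v) ∈ σ ∧ (x : Color) = c := by
  simp only [colorClass, mem_image, mem_filter]
  constructor
  · rintro ⟨⟨w, x⟩, h, rfl⟩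
    exact ⟨x, h⟩
  · rintro ⟨x, h⟩
    exact ⟨⟨v, x⟩, h, rfl⟩

omit [Fintype V] in
theorem colorClass_mono {c : Color} {σ τ : Finset (Σ v, L v)} (h : σ ⊆ τ) :
    colorClass c σ ⊆ colorClass c τ :=
  image_subset_image (filter_subset_filter _ h)

omit [Fintype V] in
theorem colorClass_erase (e : Σ v, L v) (σ : Finset (Σ v, L v)) :
    colorClass (e.2 : Color) (σ.erase e) = (colorClass (e.2 : Color) σ).erase e.1 := by
  obtain ⟨w, x⟩ := e
  ext v
  simp only [mem_colorClass, mem_erase]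
  constructor
  · rintro ⟨y, ⟨hne, hy⟩, hyx⟩
    refine ⟨?_, y, hy, hyx⟩
    rintro rfl
    exact hne (by rw [Subtype.ext hyx])
  · rintro ⟨hne, y, hy, hyx⟩
    refine ⟨y, ⟨fun h => hne (congrArg Sigma.fst h), hy⟩, hyx⟩

omit [Fintype V] in
theorem colorClass_erase_of_ne {c : Color} {e : Σ v, L v} (h : (e.2 : Color) ≠ c)
    (σ : Finset (Σ v, L v)) : colorClass c (σ.erase e) = colorClass c σ := by
  unfold colorClass
  rw [filter_erase, erase_eq_of_notMem (by simp [h])]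

theorem FinMatroid.spanBound (M : FinMatroid V) (hM : ∀ v, M.Indep {v}) :
    SpanBound (fun σ : Finset (Σ v, L v) => ∀ c, M.Indep (colorClass c σ)) (chrom M.Indep) := by
  refine ⟨fun σ => {e | e.1 ∈ M.closure (colorClass (e.2 : Color) σ)}, fun ω e he => ?_,
    fun ω e he hω hωe => ?_, fun σ hσ => ?_⟩
  · refine mem_filter.2 ⟨mem_univ _, M.subset_closure _ (mem_colorClass.2 ⟨e.2, he, rfl⟩)⟩
  · have key : ∀ c, M.closure (colorClass c (ω.erase e)) = M.closure (colorClass c ω) := by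
      intro c
      by_cases hc : (e.2 : Color) = c
      · subst hc
        have h1 := hωe e.2
        rw [colorClass_erase] at h1 ⊢
        refine closure_erase (mem_colorClass.2 ⟨e.2, he, rfl⟩) (fun h => hω fun c => ?_) h1
        by_cases hc : (e.2 : Color) = c
        · rwa [← hc]
        · rw [← colorClass_erase_of_ne hc]
          exact hωe c
      · rw [colorClass_erase_of_ne hc]
    simp only [key]
  · have hcol : ∀ s : Finset (Σ v, L v),
        #s = ∑ c ∈ univ.biUnion L, #{e ∈ s | (e.2 : Color) = c} := fun s =>
      card_eq_sum_card_fiberwise fun e _ => by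
        simpa using ⟨e.1, e.2.2⟩
    have hinj : ∀ (c : Color) (s : Finset (Σ v, L v)),
        #(colorClass c s) = #{e ∈ s | (e.2 : Color) = c} := by
      intro c s
      refine card_image_of_injOn ?_
      rintro ⟨v, x⟩ hx ⟨w, y⟩ hy hvw
      obtain rfl : v = w := hvw
      simp only [coe_filter, Set.mem_ofPred_eq] at hx hy
      rw [Subtype.ext (hx.2.trans hy.2.symm)]
    rw [hcol, hcol σ, mul_sum]
    refine sum_le_sum fun c _ => ?_
    rw [← hinj, ← hinj]
    refine (card_le_card fun v hv => ?_).trans (card_closure_le hM (hσ c))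
    obtain ⟨x, hx, rfl⟩ := mem_colorClass.1 hv
    exact (mem_filter.1 hx).2

end FinMatroid

/-- For two (loopless) matroids `M` and `N` on the same finite ground set `V`,
`χ_ℓ(M ∩ N) ≤ χ(M) + χ(N)`: for any assignment of lists of `χ(M) + χ(N)` colors
to the vertices, there is a choice function whose color classes are all
independent in both `M` and `N`. -/
theorem listChromatic_inter_le_add_chromatic {V : Type*} [DecidableEq V] [Fintype V]
    (M N : FinMatroid V) (hM : ∀ v : V, M.Indep {v}) (hN : ∀ v : V, N.Indep {v})
    {Color : Type*} [DecidableEq Color] (L : V → Finset Color)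
    (hL : ∀ v : V, (L v).card = chrom M.Indep + chrom N.Indep) :
    ∃ f : V → Color, (∀ v : V, f v ∈ L v) ∧
      ∀ c : Color, M.Indep (Finset.univ.filter fun v => f v = c) ∧
        N.Indep (Finset.univ.filter fun v => f v = c) := by
  rcases isEmpty_or_nonempty V with hV | ⟨⟨v₀⟩⟩
  · refine ⟨fun v => (hV.false v).elim, fun v => (hV.false v).elim, fun c => ?_⟩
    rw [Finset.univ_eq_empty, Finset.filter_empty]
    exact ⟨M.empty_indep, N.empty_indep⟩
  have hpos : 0 < chrom M.Indep + chrom N.Indep := by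
    obtain ⟨f, -, hf⟩ := M.exists_cover hM
    obtain ⟨i, -⟩ := hf v₀
    exact Nat.add_pos_left i.pos _
  have hfib (v : V) : chrom M.Indep + chrom N.Indep ≤
      (Finset.univ.filter fun e : Σ v, L v => e.1 = v).card := by
    rw [← hL v, ← Fintype.card_coe, ← Finset.card_univ]
    refine Finset.card_le_card_of_injOn (fun x => ⟨v, x⟩) (by simp) ?_
    intro x _ y _ h
    simpa using h
  obtain ⟨σ, hσM, hσN, hσ⟩ := exists_transversal (M.spanBound hM) (N.spanBound hN)
    (fun σ τ h hs c => M.subset_indep (h c) (colorClass_mono hs))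
    (fun σ τ h hs c => N.subset_indep (h c) (colorClass_mono hs))
    (fun c => by simpa [colorClass] using M.empty_indep)
    (fun c => by simpa [colorClass] using N.empty_indep)
    (Sigma.fst : (Σ v, L v) → V) hpos hfib
  have hσ' (v : V) : ∃ x : L v, (⟨v, x⟩ : Σ v, L v) ∈ σ := by
    obtain ⟨⟨w, x⟩, he, rfl⟩ := hσ v
    exact ⟨x, he⟩
  choose f hf using hσ'
  have hsub (c : Color) : (Finset.univ.filter fun v => (f v : Color) = c) ⊆ colorClass c σ :=
    fun v hv => mem_colorClass.2 ⟨f v, hf v, (Finset.mem_filter.1 hv).2⟩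
  exact ⟨fun v => f v, fun v => (f v).2, fun c =>
    ⟨M.subset_indep (hσM c) (hsub c), N.subset_indep (hσN c) (hsub c)⟩⟩
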